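/- Let p ≥ 1 and let t = (t_1, …, t_{N+p+1}) be a knot vector of degree p (nondecreasing with t_i < t_{i+p+1} for all i). Define the Greville points ξ_i = (t_{i+1} + t_{i+2} + … + t_{i+p}) / p for i = 1, …, N. Then the B-splines reproduce the identity with Greville coefficients: Σ_{i=1}^N ξ_i B_{i,p}(x) = x for all x ∈ [t_{p+1}, t_{N+1}). -/

import Mathlib

/-- The Cox–de Boor recursion defining the B-spline `B_{i,p}` of degree `p` with
index `i` over the knot sequence `t` (0-indexed): `bspline t i p` uses the knots
`t i, …, t (i+p+1)`.  Any term whose denominator vanishes is automatically `0`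
since division by zero is `0` in Lean. -/
noncomputable def bspline (t : ℕ → ℝ) : ℕ → ℕ → ℝ → ℝ
  | i, 0, x => if t i ≤ x ∧ x < t (i + 1) then 1 else 0
  | i, p + 1, x =>
      (x - t i) / (t (i + p + 1) - t i) * bspline t i p x +
        (t (i + p + 2) - x) / (t (i + p + 2) - t (i + 1)) * bspline t (i + 1) p x

theorem bspline_eq_zero {t : ℕ → ℝ} {i p : ℕ} {x : ℝ}
    (ht : MonotoneOn t (Set.Icc i (i + p + 1))) (hx : x < t i ∨ t (i + p + 1) ≤ x) :
    bspline t i p x = 0 := by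
  induction p generalizing i with
  | zero =>
    rw [bspline, if_neg]
    rintro ⟨h₁, h₂⟩
    exact hx.elim (fun h => h.not_ge h₁) (fun h => h.not_gt h₂)
  | succ p ih =>
    have hl : t i ≤ t (i + 1) :=
      ht (Set.mem_Icc.mpr (by omega)) (Set.mem_Icc.mpr (by omega)) (by omega)
    have hr : t (i + p + 1) ≤ t (i + (p + 1) + 1) :=
      ht (Set.mem_Icc.mpr (by omega)) (Set.mem_Icc.mpr (by omega)) (by omega)
    rw [bspline, ih (ht.mono (Set.Icc_subset_Icc_right (by omega))), ih (i := i + 1)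
      (ht.mono (Set.Icc_subset_Icc (by omega) (by omega)))]
    · simp
    · rw [show i + 1 + p + 1 = i + (p + 1) + 1 by ring]
      exact hx.imp (fun h => h.trans_le hl) id
    · exact hx.imp id hr.trans

theorem bspline_shift (t : ℕ → ℝ) (i p : ℕ) (x : ℝ) :
    bspline (fun n => t (n + 1)) i p x = bspline t (i + 1) p x := by
  induction p generalizing i with
  | zero => simp [bspline]
  | succ p ih =>
    simp only [bspline, ih]
    rw [show i + 1 + p + 1 = i + p + 1 + 1 by ring, show i + 1 + p + 2 = i + p + 2 + 1 by ring]

/-- Expanding a spline of degree `p + 1` in the B-splines of degree `p` on the interior knots. -/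
theorem sum_mul_bspline_succ {t : ℕ → ℝ} {p N : ℕ} {x : ℝ} (c : ℕ → ℝ)
    (ht : MonotoneOn t (Set.Iic (N + 1 + (p + 1)))) (hx₁ : t (p + 1) ≤ x) (hx₂ : x < t (N + 1)) :
    ∑ i ∈ Finset.range (N + 1), c i * bspline t i (p + 1) x =
      ∑ i ∈ Finset.range N,
        ((x - t (i + 1)) * c (i + 1) + (t (i + p + 2) - x) * c i) / (t (i + p + 2) - t (i + 1)) *
          bspline t (i + 1) p x := by
  have h₀ : bspline t 0 p x = 0 :=
    bspline_eq_zero (ht.mono fun j hj => by simp at hj ⊢; omega) (Or.inr (by simpa using hx₁))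
  have hN : bspline t (N + 1) p x = 0 :=
    bspline_eq_zero (ht.mono fun j hj => by simp at hj ⊢; omega) (Or.inl hx₂)
  simp only [bspline, mul_add, Finset.sum_add_distrib]
  rw [Finset.sum_range_succ', Finset.sum_range_succ _ N, h₀, hN]
  simp only [mul_zero, add_zero]
  rw [← Finset.sum_add_distrib]
  refine Finset.sum_congr rfl fun i _ => ?_
  rw [show i + 1 + p + 1 = i + p + 2 by ring]
  ring

theorem div_mul_bspline_succ {t : ℕ → ℝ} {i p : ℕ} {x : ℝ} (a : ℝ)
    (ht : MonotoneOn t (Set.Icc (i + 1) (i + p + 2))) :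
    a * (t (i + p + 2) - t (i + 1)) / (t (i + p + 2) - t (i + 1)) * bspline t (i + 1) p x =
      a * bspline t (i + 1) p x := by
  by_cases h : t (i + p + 2) - t (i + 1) = 0
  · rw [bspline_eq_zero (i := i + 1)]
    · simp
    · rwa [show i + 1 + p + 1 = i + p + 2 by ring]
    · rw [show i + 1 + p + 1 = i + p + 2 by ring, sub_eq_zero.mp h]
      exact lt_or_ge _ _
  · rw [mul_div_cancel_right₀ _ h]

theorem sum_bspline_eq_one {t : ℕ → ℝ} {p N : ℕ} {x : ℝ}
    (ht : MonotoneOn t (Set.Iic (N + p))) (hx₁ : t p ≤ x) (hx₂ : x < t N) :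
    ∑ i ∈ Finset.range N, bspline t i p x = 1 := by
  induction p generalizing t N with
  | zero =>
    have key : ∀ i ∈ Finset.range N, bspline t i 0 x =
        (if t i ≤ x then (1 : ℝ) else 0) - if t (i + 1) ≤ x then 1 else 0 := by
      intro i hi
      have hi := Finset.mem_range.mp hi
      have h : t i ≤ t (i + 1) := ht (by simp; omega) (by simp; omega) (by omega)
      rw [bspline]
      split_ifs <;> grind
    rw [Finset.sum_congr rfl key,
      Finset.sum_range_sub' (fun i => if t i ≤ x then (1 : ℝ) else 0),
      if_pos hx₁, if_neg hx₂.not_ge, sub_zero]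
  | succ p ih =>
    obtain _ | N := N
    · exact absurd (ht (by simp) (by simp) (Nat.zero_le _)) (hx₁.trans_lt hx₂).not_ge
    have h := sum_mul_bspline_succ (fun _ => 1) ht hx₁ hx₂
    simp only [one_mul] at h
    have ht' : MonotoneOn (fun n => t (n + 1)) (Set.Iic (N + p)) := fun a ha b hb hab =>
      ht (by simp at ha ⊢; omega) (by simp at hb ⊢; omega) (by omega)
    rw [h]
    refine (Finset.sum_congr rfl fun i hi => ?_).trans (ih ht' hx₁ hx₂)
    have hi := Finset.mem_range.mp hi
    rw [bspline_shift, ← one_mul (bspline t (i + 1) p x)]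
    refine Eq.trans ?_ (div_mul_bspline_succ 1 (ht.mono fun j hj => by simp at hj ⊢; omega))
    ring

theorem sum_knots_mul_bspline {t : ℕ → ℝ} {p N : ℕ} {x : ℝ}
    (ht : MonotoneOn t (Set.Iic (N + p))) (hx₁ : t p ≤ x) (hx₂ : x < t N) :
    ∑ i ∈ Finset.range N, (∑ j ∈ Finset.range p, t (i + 1 + j)) * bspline t i p x = p * x := by
  induction p generalizing t N with
  | zero => simp
  | succ p ih =>
    obtain _ | N := N
    · exact absurd (ht (by simp) (by simp) (Nat.zero_le _)) (hx₁.trans_lt hx₂).not_ge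
    have ht' : MonotoneOn (fun n => t (n + 1)) (Set.Iic (N + p)) := fun a ha b hb hab =>
      ht (by simp at ha ⊢; omega) (by simp at hb ⊢; omega) (by omega)
    rw [sum_mul_bspline_succ _ ht hx₁ hx₂]
    have hsum : ((p + 1 : ℕ) : ℝ) * x =
        ∑ i ∈ Finset.range N, (∑ j ∈ Finset.range p, t (i + 1 + j + 1) + x) *
          bspline (fun n => t (n + 1)) i p x := by
      simp only [add_mul, Finset.sum_add_distrib]
      rw [ih ht' hx₁ hx₂, ← Finset.mul_sum, sum_bspline_eq_one ht' hx₁ hx₂]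
      push_cast
      ring
    rw [hsum]
    refine Finset.sum_congr rfl fun i hi => ?_
    have hi := Finset.mem_range.mp hi
    rw [bspline_shift]
    refine Eq.trans ?_ (div_mul_bspline_succ _ (ht.mono fun j hj => by simp at hj ⊢; omega))
    congr 2
    rw [Finset.sum_range_succ, Finset.sum_range_succ' (fun j => t (i + 1 + j))]
    rw [show i + 1 + 1 + p = i + p + 2 by ring]
    have hS : ∑ j ∈ Finset.range p, t (i + 1 + 1 + j) = ∑ j ∈ Finset.range p, t (i + 1 + j + 1) :=
      Finset.sum_congr rfl fun j _ => by rw [add_right_comm]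
    simp only [hS, add_zero, ← add_assoc]
    ring

/-- for `p ≥ 1` and a knot vector `t = (t_0, …, t_{N+p})` of degree
`p`, the Greville points `ξ_i = (t_{i+1} + … + t_{i+p}) / p` reproduce the
identity: `∑ ξ_i B_{i,p}(x) = x` for all `x ∈ [t_p, t_N)` (1-based:
`[t_{p+1}, t_{N+1})`). -/
theorem bspline_greville_identity (p N : ℕ) (hp : 1 ≤ p) (t : ℕ → ℝ)
    (hmono : ∀ i j, i ≤ j → j ≤ N + p → t i ≤ t j)
    (hknot : ∀ i, i < N → t i < t (i + p + 1))
    (x : ℝ) (hx1 : t p ≤ x) (hx2 : x < t N) :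
    ∑ i ∈ Finset.range N,
        ((∑ j ∈ Finset.range p, t (i + 1 + j)) / (p : ℝ)) * bspline t i p x = x := by
  have ht : MonotoneOn t (Set.Iic (N + p)) := fun i _ j hj hij => hmono i j hij hj
  have hp' : (p : ℝ) ≠ 0 := by exact_mod_cast (by omega : p ≠ 0)
  simp only [div_mul_eq_mul_div]
  rw [← Finset.sum_div, sum_knots_mul_bspline ht hx1 hx2, mul_div_cancel_left₀ _ hp']
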